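/- Under Assumptions (A) and (B), let ρ = (ρ_1,…,ρ_d) ∈ ℝ^d satisfy (ρP)_i < ρ_i for all i, and let ε > 0 be such that the vector (ε G_{ii}/ρ_i; 1 ≤ i ≤ d) belongs to Γ and 0 < ε < min_{1≤i≤d} (ρ_i/G_{ii})(μ_i/ν_i − 1). Then the function h_{ε,ρ}(x) = Σ_{i=1}^d Π_{j=1}^d (1 + ε G_{ji}/ρ_i)^{x^j} satisfies limsup_{|x|→∞, x∈ℤ_+^d} (ℒh_{ε,ρ})(x)/h_{ε,ρ}(x) = − ε · min_{1≤i≤d} (μ_i/(ρ_i + ε G_{ii}) − ν_i/ρ_i) < 0. In particular, these hypotheses hold whenever 0 < ε < min_{1≤i≤d} min{(ρ_i/G_{ii}) x_ρ, (ρ_i/G_{ii})(μ_i/ν_i − 1)}. -/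

import Mathlib

open scoped BigOperators
open Filter

/-- The `i`-th standard unit vector in `ℤ^d`. -/
def unitZ {d : ℕ} (i : Fin d) : Fin d → ℤ := fun k => if k = i then 1 else 0

/-- The jump rates `q(y)` of the Jackson network: `q(ε^i) = λ_i`,
`q(-ε^i) = μ_i p_{i0}`, `q(ε^j - ε^i) = μ_i p_{ij}` and `q(y) = 0` otherwise. -/
noncomputable def qrate {d : ℕ} (lam mu : Fin d → ℝ) (P : Fin d → Fin d → ℝ)
    (y : Fin d → ℤ) : ℝ :=
  (∑ i, lam i * (if y = unitZ i then 1 else 0))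
    + (∑ i, mu i * (1 - ∑ j, P i j) * (if y = -unitZ i then 1 else 0))
    + (∑ i, ∑ j, mu i * P i j * (if y = unitZ j - unitZ i then 1 else 0))

/-- Assumption (A): irreducibility of the matrix `(q(x - y); x, y ∈ ℤ^d)`. -/
def AssumptionA {d : ℕ} (lam mu : Fin d → ℝ) (P : Fin d → Fin d → ℝ) : Prop :=
  ∀ x y : Fin d → ℤ, ∃ (n : ℕ) (c : Fin (n + 1) → Fin d → ℤ),
    c 0 = x ∧ c (Fin.last n) = y ∧
      ∀ k : Fin n, 0 < qrate lam mu P (c k.succ - c k.castSucc)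

/-- The generator `ℒ` of the Jackson network:
`(ℒ f)(x) = ∑_{z ∈ ℤ_+^d} q(z - x) (f z - f x)`. -/
noncomputable def gen {d : ℕ} (lam mu : Fin d → ℝ) (P : Fin d → Fin d → ℝ)
    (f : (Fin d → ℕ) → ℝ) (x : Fin d → ℕ) : ℝ :=
  ∑' z : Fin d → ℕ, qrate lam mu P (fun k => (z k : ℤ) - (x k : ℤ)) * (f z - f x)

/-- The hitting-probability matrix `Q j i = G j i / G i i`. -/
noncomputable def hitQ {d : ℕ} (G : Fin d → Fin d → ℝ) : Fin d → Fin d → ℝ :=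
  fun j i => G j i / G i i

/-- The vector `γ⃗_i`, with components `γ_i^j = log (1 + Q j i * γ i)`. -/
noncomputable def gvec {d : ℕ} (Q : Fin d → Fin d → ℝ) (γ : Fin d → ℝ) (i j : Fin d) : ℝ :=
  Real.log (1 + Q j i * γ i)

/-- The set `Γ`: all `γ ∈ ℝ_+^d` such that for every `i` and every nonzero
`v ∈ ℝ_+^d` with `v i = 0` one has `γ⃗_i ⬝ v < max_j γ⃗_j ⬝ v`. -/
def GammaSet (d : ℕ) (Q : Fin d → Fin d → ℝ) : Set (Fin d → ℝ) :=
  {γ | (∀ i, 0 ≤ γ i) ∧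
    ∀ i : Fin d, ∀ v : Fin d → ℝ, (∀ j, 0 ≤ v j) → v ≠ 0 → v i = 0 →
      (∑ j, gvec Q γ i j * v j) < ⨆ l : Fin d, ∑ j, gvec Q γ l j * v j}

/-- The quantity 𝓡(ρ) = max_i (ρP)_i / ρ_i. -/
noncomputable def Rrho {d : ℕ} (P : Fin d → Fin d → ℝ) (ρ : Fin d → ℝ) : ℝ :=
  ⨆ i : Fin d, (∑ j, ρ j * P j i) / ρ i

/-- The quantity x_ρ = sup {x > 0 : log(1+x) ≥ 𝓡(ρ)·x} ∈ (0, ∞], as an extended real. -/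
noncomputable def xrho (R : ℝ) : EReal :=
  sSup {y : EReal | ∃ x : ℝ, y = (x : EReal) ∧ 0 < x ∧ R * x ≤ Real.log (1 + x)}

lemma hasSum_shift {d : ℕ} {x w : Fin d → ℕ} {y : Fin d → ℤ}
    (hw : ∀ k, (w k : ℤ) = x k + y k) (g : (Fin d → ℕ) → ℝ) :
    HasSum (fun z : Fin d → ℕ =>
      (if (fun k => (z k : ℤ) - (x k : ℤ)) = y then (1 : ℝ) else 0) * g z) (g w) := by
  convert hasSum_single w ?_ using 1
  · have : (fun k => (w k : ℤ) - (x k : ℤ)) = y := by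
      funext k
      rw [hw]
      ring
    simp [this]
  · intro z hz
    rw [if_neg, zero_mul]
    intro h
    apply hz
    funext k
    have hz : (z k : ℤ) - x k = y k := congrFun h k
    have := hw k
    omega

lemma hasSum_shift_of_neg {d : ℕ} {x : Fin d → ℕ} {y : Fin d → ℤ} {k : Fin d}
    (hk : (x k : ℤ) + y k < 0) (g : (Fin d → ℕ) → ℝ) :
    HasSum (fun z : Fin d → ℕ =>
      (if (fun k => (z k : ℤ) - (x k : ℤ)) = y then (1 : ℝ) else 0) * g z) 0 := by
  convert hasSum_zero using 2 with z
  rw [if_neg, zero_mul]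
  intro h
  have hz : (z k : ℤ) - x k = y k := congrFun h k
  omega

/-- The sum of `g` against the jump rates out of `x`, in closed form. -/
lemma hasSum_gen {d : ℕ} (lam mu : Fin d → ℝ) (P : Fin d → Fin d → ℝ) (hPdiag : ∀ i, P i i = 0)
    (g : (Fin d → ℕ) → ℝ) (x : Fin d → ℕ) :
    HasSum (fun z : Fin d → ℕ => qrate lam mu P (fun k => (z k : ℤ) - (x k : ℤ)) * g z)
      ((∑ i, lam i * g (x + Pi.single i 1))
        + (∑ i, mu i * (1 - ∑ j, P i j) * (if 0 < x i then g (x - Pi.single i 1) else 0))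
        + ∑ i, ∑ j, mu i * P i j *
            (if 0 < x i then g (x - Pi.single i 1 + Pi.single j 1) else 0)) := by
  simp only [qrate, add_mul, Finset.sum_mul, mul_assoc _ (ite _ _ _) (g _)]
  refine ((hasSum_sum fun i _ => ?_).add (hasSum_sum fun i _ => ?_)).add
    (hasSum_sum fun i _ => hasSum_sum fun j _ => ?_)
  · refine (hasSum_shift (fun k => ?_) g).mul_left _
    by_cases h : k = i <;> simp [unitZ, h]
  · refine HasSum.mul_left _ ?_
    split_ifs with hx
    · refine hasSum_shift (fun k => ?_) g
      by_cases h : k = i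
      · subst h
        simp [unitZ]
        omega
      · simp [unitZ, h]
    · refine hasSum_shift_of_neg (k := i) ?_ g
      simp [unitZ]
      omega
  · by_cases hij : i = j
    · subst hij
      simp [hPdiag]
    refine HasSum.mul_left _ ?_
    split_ifs with hx
    · refine hasSum_shift (fun k => ?_) g
      by_cases h : k = i
      · subst h
        simp [unitZ, hij]
        omega
      · simp [unitZ, h, Pi.single_apply]
    · refine hasSum_shift_of_neg (k := i) ?_ g
      simp [unitZ, hij]
      omega

lemma prod_pow_add_single {d : ℕ} (a : Fin d → ℝ) (x : Fin d → ℕ) (k : Fin d) :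
    ∏ j, a j ^ (x + Pi.single k 1 : Fin d → ℕ) j = a k * ∏ j, a j ^ x j := by
  simp only [Pi.add_apply, pow_add, Finset.prod_mul_distrib]
  rw [mul_comm, Finset.prod_eq_single k] <;> simp +contextual

lemma prod_pow_sub_single {d : ℕ} {a : Fin d → ℝ} {x : Fin d → ℕ} {k : Fin d} (ha : a k ≠ 0)
    (hx : 0 < x k) :
    ∏ j, a j ^ (x - Pi.single k 1 : Fin d → ℕ) j = (∏ j, a j ^ x j) / a k := by
  have : x - Pi.single k 1 + Pi.single k 1 = x :=
    tsub_add_cancel_of_le fun j => by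
      by_cases h : j = k
      · subst h
        simpa [Nat.one_le_iff_ne_zero] using hx.ne'
      · simp [h]
  conv_rhs => rw [← this, prod_pow_add_single]
  field_simp

/-- The generator applied to the product form function with factors `1 + c g_j`, where `g` is the
`i`-th column of the Green matrix. -/
lemma hasSum_gen_prod {d : ℕ} {lam mu : Fin d → ℝ} {P : Fin d → Fin d → ℝ}
    (hPdiag : ∀ i, P i i = 0) {g : Fin d → ℝ} (hg : ∀ j, 0 ≤ g j) {i : Fin d}
    (hgP : ∀ j, ∑ k, P j k * g k = g j - if j = i then 1 else 0) {c : ℝ} (hc : 0 ≤ c)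
    (x : Fin d → ℕ) :
    HasSum (fun z : Fin d → ℕ => qrate lam mu P (fun k => (z k : ℤ) - (x k : ℤ)) *
        (∏ j, (1 + c * g j) ^ z j - ∏ j, (1 + c * g j) ^ x j))
      ((∏ j, (1 + c * g j) ^ x j) *
        (c * ∑ j, lam j * g j - if 0 < x i then mu i * c / (1 + c * g i) else 0)) := by
  have hpos : ∀ j, 0 < 1 + c * g j := fun j => by
    have := mul_nonneg hc (hg j)
    linarith
  convert hasSum_gen lam mu P hPdiag
    (fun z => ∏ j, (1 + c * g j) ^ z j - ∏ j, (1 + c * g j) ^ x j) x using 1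
  simp only [prod_pow_add_single]
  set H := ∏ j, (1 + c * g j) ^ x j with hH
  have departure : ∀ j, mu j * (1 - ∑ k, P j k) *
        (if 0 < x j then ∏ l, (1 + c * g l) ^ (x - Pi.single j 1 : Fin d → ℕ) l - H else 0)
      + ∑ k, mu j * P j k *
        (if 0 < x j then (1 + c * g k) * ∏ l, (1 + c * g l) ^ (x - Pi.single j 1 : Fin d → ℕ) l - H else 0)
      = if j = i then -(H * if 0 < x i then mu i * c / (1 + c * g i) else 0) else 0 := by
    intro j
    by_cases hx : 0 < x j
    · simp only [hx, if_true, prod_pow_sub_single (a := fun l => 1 + c * g l) (hpos j).ne' hx, ← hH]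
      have expand : ∑ k, mu j * P j k * ((1 + c * g k) * (H / (1 + c * g j)) - H)
          = mu j * (H / (1 + c * g j) - H) * ∑ k, P j k
            + mu j * c * (H / (1 + c * g j)) * ∑ k, P j k * g k := by
        simp only [Finset.mul_sum, ← Finset.sum_add_distrib]
        exact Finset.sum_congr rfl fun k _ => by ring
      rw [expand, hgP]
      have := (hpos j).ne'
      split_ifs with h h'
      · subst h
        field_simp
        ring
      · subst h
        exact absurd hx h'
      · field_simp
        ring
    · have : ∀ b : ℝ, (if j = i then -(H * if 0 < x i then b else 0) else 0) = 0 := by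
        intro b
        split_ifs with h h' <;> simp
        subst h
        exact absurd h' hx
      rw [this]
      simp [hx]
  rw [add_assoc, ← Finset.sum_add_distrib, Finset.sum_congr rfl fun j _ => departure j]
  simp only [Finset.sum_ite_eq', Finset.mem_univ, if_true]
  have : ∑ j, lam j * ((1 + c * g j) * H - H) = H * (c * ∑ j, lam j * g j) := by
    simp only [Finset.mul_sum]
    exact Finset.sum_congr rfl fun k _ => by ring
  rw [this]
  ring

lemma limsup_eq_of_forall_eventually_of_forall_frequently {α : Type*} {l : Filter α} {F : α → ℝ}
    {L : ℝ} (hle : ∀ δ > 0, ∀ᶠ x in l, F x ≤ L + δ) (hge : ∀ δ > 0, ∃ᶠ x in l, L - δ ≤ F x) :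
    Filter.limsup F l = L := by
  apply le_antisymm
  · refine le_of_forall_pos_le_add fun δ hδ => ?_
    exact limsup_le_of_le (IsCoboundedUnder.of_frequently_ge (hge δ hδ)) (hle δ hδ)
  · refine le_of_forall_pos_sub_le fun δ hδ => ?_
    exact le_limsup_of_frequently_le (hge δ hδ) ⟨_, (hle 1 one_pos)⟩

lemma green_apply_eq_sum {d : ℕ} {P G : Fin d → Fin d → ℝ}
    (hGP : ∀ i k, ∑ j, G i j * P j k = G i k - if i = k then 1 else 0) (u : Fin d → ℝ)
    (i : Fin d) : ∑ j, G i j * (u j - ∑ l, P j l * u l) = u i := by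
  have : ∑ j, G i j * ∑ l, P j l * u l = ∑ l, G i l * u l - u i := by
    simp only [Finset.mul_sum]
    rw [Finset.sum_comm]
    simp only [← mul_assoc, ← Finset.sum_mul, hGP, sub_mul, Finset.sum_sub_distrib]
    simp
  simp only [mul_sub, Finset.sum_sub_distrib, this]
  ring

lemma apply_green_eq_sum {d : ℕ} {P G : Fin d → Fin d → ℝ}
    (hPG : ∀ i k, ∑ j, P i j * G j k = G i k - if i = k then 1 else 0) (u : Fin d → ℝ)
    (i : Fin d) : ∑ j, (u j - ∑ l, u l * P l j) * G j i = u i := by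
  have : ∑ j, (∑ l, u l * P l j) * G j i = ∑ l, u l * G l i - u i := by
    simp only [Finset.sum_mul]
    rw [Finset.sum_comm]
    simp only [mul_assoc, ← Finset.mul_sum, hPG, mul_sub, Finset.sum_sub_distrib]
    simp
  simp only [sub_mul, Finset.sum_sub_distrib, this]
  ring

/-- The Green matrix of a substochastic matrix is maximal on the diagonal in each column. -/
lemma green_le_diag {d : ℕ} {P G : Fin d → Fin d → ℝ} (hP : ∀ i j, 0 ≤ P i j)
    (hP0 : ∀ i, ∑ j, P i j ≤ 1) (hGnn : ∀ i j, 0 ≤ G i j)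
    (hGP : ∀ i k, ∑ j, G i j * P j k = G i k - if i = k then 1 else 0)
    (hPG : ∀ i k, ∑ j, P i j * G j k = G i k - if i = k then 1 else 0) (j k : Fin d) :
    G j k ≤ G k k := by
  set u : Fin d → ℝ := fun j => max (G j k - G k k) 0 with hu
  have hu0 : ∀ j, 0 ≤ u j := fun j => le_max_right _ _
  have hPu0 : ∀ j, 0 ≤ ∑ l, P j l * u l := fun j =>
    Finset.sum_nonneg fun l _ => mul_nonneg (hP j l) (hu0 l)
  have hPu : ∀ j, u j ≤ ∑ l, P j l * u l := by
    intro j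
    apply max_le _ (hPu0 j)
    by_cases hj : j = k
    · subst hj
      simpa using hPu0 j
    have h1 : ∑ l, P j l * (G l k - G k k) ≤ ∑ l, P j l * u l :=
      Finset.sum_le_sum fun l _ => mul_le_mul_of_nonneg_left (le_max_left _ _) (hP j l)
    simp only [mul_sub, Finset.sum_sub_distrib, hPG, if_neg hj, ← Finset.sum_mul] at h1
    have h2 := mul_le_mul_of_nonneg_right (hP0 j) (hGnn k k)
    linarith
  have hle : u j ≤ 0 := by
    rw [← green_apply_eq_sum hGP u j]
    exact Finset.sum_nonpos fun l _ =>
      mul_nonpos_of_nonneg_of_nonpos (hGnn j l) (sub_nonpos.2 (hPu l))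
  have := (le_max_left _ _).trans hle
  linarith

/-- By concavity, `R x ≤ log (1 + x)` holds on the whole interval up to `x_ρ`. -/
lemma mul_le_log_one_add_of_lt_xrho {R γ : ℝ} (hγ : (γ : EReal) < xrho R) {x : ℝ} (hx : 0 ≤ x)
    (hxγ : x ≤ γ) : R * x ≤ Real.log (1 + x) := by
  obtain ⟨_, ⟨y, rfl, hy, hRy⟩, hlt⟩ := lt_sSup_iff.1 hγ
  have hxy : x < y := hxγ.trans_lt (EReal.coe_lt_coe_iff.1 hlt)
  have ht : x / y ≤ 1 := (div_le_one hy).2 hxy.le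
  have h := strictConcaveOn_log_Ioi.concaveOn.2 (Set.mem_Ioi.2 one_pos)
    (Set.mem_Ioi.2 (by linarith : 0 < 1 + y)) (sub_nonneg.2 ht) (div_nonneg hx hy.le)
    (sub_add_cancel 1 (x / y))
  have harg : (1 - x / y) • (1 : ℝ) + (x / y) • (1 + y) = 1 + x := by
    simp only [smul_eq_mul]
    field_simp
    ring
  rw [harg] at h
  simp only [smul_eq_mul, Real.log_one, mul_zero, zero_add] at h
  calc R * x = x / y * (R * y) := by field_simp
    _ ≤ x / y * Real.log (1 + y) := mul_le_mul_of_nonneg_left hRy (by positivity)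
    _ ≤ _ := h

lemma gvec_hitQ {d : ℕ} {G : Fin d → Fin d → ℝ} {l : Fin d} (hG : G l l ≠ 0) (ρ : Fin d → ℝ)
    (ε : ℝ) (j : Fin d) :
    gvec (hitQ G) (fun i => ε * G i i / ρ i) l j = Real.log (1 + ε * G j l / ρ l) := by
  simp only [gvec, hitQ]
  congr 2
  field_simp

/-- The vectors `(ε G_ii / ρ_i)` with `ε G_ii / ρ_i < x_ρ` belong to `Γ`. -/
lemma mem_GammaSet_of_lt_xrho {d : ℕ} {P G : Fin d → Fin d → ℝ} (hP : ∀ i j, 0 ≤ P i j)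
    (hP0 : ∀ i, ∑ j, P i j ≤ 1) (hGnn : ∀ i j, 0 ≤ G i j) (hGdiag : ∀ i, 0 < G i i)
    (hGP : ∀ i k, ∑ j, G i j * P j k = G i k - if i = k then 1 else 0)
    (hPG : ∀ i k, ∑ j, P i j * G j k = G i k - if i = k then 1 else 0)
    {ρ : Fin d → ℝ} (hρ : ∀ i, 0 < ρ i) {ε : ℝ} (hε : 0 < ε)
    (hx : ∀ i, ((ε * G i i / ρ i : ℝ) : EReal) < xrho (Rrho P ρ)) :
    (fun i => ε * G i i / ρ i) ∈ GammaSet d (hitQ G) := by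
  refine ⟨fun i => by have := hGdiag i; have := hρ i; positivity, fun i v hv hv0 hvi => ?_⟩
  have hgvec : ∀ l j, gvec (hitQ G) (fun i => ε * G i i / ρ i) l j
      = Real.log (1 + ε * G j l / ρ l) := fun l j =>
    gvec_hitQ (hGdiag l).ne' ρ ε j
  simp only [hgvec]
  set R := Rrho P ρ with hR
  have hRle : ∀ l, (∑ k, ρ k * P k l) / ρ l ≤ R := fun l =>
    le_ciSup (f := fun l => (∑ k, ρ k * P k l) / ρ l) (Finite.bddAbove_range _) l
  have hR0 : 0 ≤ R := (div_nonneg (Finset.sum_nonneg fun k _ => mul_nonneg (hρ k).le (hP k i))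
    (hρ i).le).trans (hRle i)
  set M := ⨆ l : Fin d, ∑ j, Real.log (1 + ε * G j l / ρ l) * v j with hM
  have hleM : ∀ l, ∑ j, Real.log (1 + ε * G j l / ρ l) * v j ≤ M := fun l =>
    le_ciSup (f := fun l => ∑ j, Real.log (1 + ε * G j l / ρ l) * v j)
      (Finite.bddAbove_range _) l
  have hx0 : ∀ j l, 0 ≤ ε * G j l / ρ l := fun j l => by
    have := hGnn j l
    have := hρ l
    positivity
  have hlog0 : ∀ j l, 0 ≤ Real.log (1 + ε * G j l / ρ l) := fun j l =>
    Real.log_nonneg (by linarith [hx0 j l])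
  have hlog_le : ∀ j l, Real.log (1 + ε * G j l / ρ l) ≤ ε * G j l / ρ l := fun j l => by
    have := Real.log_le_sub_one_of_pos (x := 1 + ε * G j l / ρ l) (by linarith [hx0 j l])
    linarith
  have hMpos : 0 < M := by
    obtain ⟨j, hj⟩ := Function.ne_iff.1 hv0
    have hvj : 0 < v j := lt_of_le_of_ne (hv j) (Ne.symm hj)
    refine lt_of_lt_of_le ?_ (hleM j)
    refine Finset.sum_pos' (fun k _ => mul_nonneg (hlog0 k j) (hv k)) ⟨j, Finset.mem_univ _, ?_⟩
    refine mul_pos (Real.log_pos ?_) hvj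
    have := hGdiag j
    have := hρ j
    have : 0 < ε * G j j / ρ j := by positivity
    linarith
  have hRX : ∀ l, R * ∑ j, ε * G j l / ρ l * v j ≤ M := fun l => by
    refine le_trans ?_ (hleM l)
    rw [Finset.mul_sum]
    refine Finset.sum_le_sum fun j _ => ?_
    rw [← mul_assoc]
    refine mul_le_mul_of_nonneg_right (mul_le_log_one_add_of_lt_xrho (hx l) (hx0 j l) ?_) (hv j)
    have := green_le_diag hP hP0 hGnn hGP hPG j l
    have := (hρ l).le
    gcongr
  have hX : ∑ j, ε * G j i / ρ i * v j
      = ∑ k, ρ k * P k i / ρ i * ∑ j, ε * G j k / ρ k * v j := by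
    simp only [Finset.mul_sum]
    rw [Finset.sum_comm]
    refine Finset.sum_congr rfl fun j _ => ?_
    by_cases hj : j = i
    · subst hj
      simp [hvi]
    have hG : G j i = ∑ k, G j k * P k i := by simp [hGP, hj]
    rw [hG]
    simp only [Finset.mul_sum, Finset.sum_div, Finset.sum_mul]
    refine Finset.sum_congr rfl fun k _ => ?_
    have := (hρ k).ne'
    field_simp
  have hθ : ∀ k, 0 ≤ ρ k * P k i / ρ i := fun k =>
    div_nonneg (mul_nonneg (hρ k).le (hP k i)) (hρ i).le
  rcases hR0.eq_or_lt with hR0 | hRpos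
  · have hθ0 : ∀ k, ρ k * P k i / ρ i = 0 := by
      have h := hRle i
      rw [← hR0, Finset.sum_div] at h
      have h' := (Finset.sum_eq_zero_iff_of_nonneg fun k _ => hθ k).1
        (le_antisymm h (Finset.sum_nonneg fun k _ => hθ k))
      exact fun k => h' k (Finset.mem_univ k)
    simp only [hθ0, zero_mul, Finset.sum_const_zero] at hX
    refine lt_of_le_of_lt ?_ hMpos
    rw [← hX]
    exact Finset.sum_le_sum fun j _ => mul_le_mul_of_nonneg_right (hlog_le j i) (hv j)
  · have hXM : ∑ j, ε * G j i / ρ i * v j ≤ M := by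
      refine le_of_mul_le_mul_left ?_ hRpos
      calc R * ∑ j, ε * G j i / ρ i * v j
          = ∑ k, ρ k * P k i / ρ i * (R * ∑ j, ε * G j k / ρ k * v j) := by
            rw [hX, Finset.mul_sum]
            exact Finset.sum_congr rfl fun k _ => by ring
        _ ≤ ∑ k, ρ k * P k i / ρ i * M :=
            Finset.sum_le_sum fun k _ => mul_le_mul_of_nonneg_left (hRX k) (hθ k)
        _ = (∑ k, ρ k * P k i) / ρ i * M := by rw [← Finset.sum_mul, Finset.sum_div]
        _ ≤ R * M := mul_le_mul_of_nonneg_right (hRle i) hMpos.le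
    by_contra! hcon
    have hex : ∃ j ∈ Finset.univ, 0 < Real.log (1 + ε * G j i / ρ i) * v j :=
      Finset.exists_lt_of_sum_lt (f := fun _ => (0 : ℝ)) (by simpa using hMpos.trans_le hcon)
    obtain ⟨j, -, hj⟩ := hex
    have hvj : 0 < v j := pos_of_mul_pos_right hj (hlog0 j i)
    have hne : ε * G j i / ρ i ≠ 0 := fun h => by simp [h] at hj
    have hlt := Real.log_lt_sub_one_of_pos (x := 1 + ε * G j i / ρ i) (by linarith [hx0 j i])
      (by simpa using hne)
    have : ∑ j, Real.log (1 + ε * G j i / ρ i) * v j < ∑ j, ε * G j i / ρ i * v j :=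
      Finset.sum_lt_sum (fun k _ => mul_le_mul_of_nonneg_right (hlog_le k i) (hv k))
        ⟨j, Finset.mem_univ _, mul_lt_mul_of_pos_right (by linarith) hvj⟩
    linarith

/-- A strict inequality between finitely many linear forms on a face of the orthant is uniform. -/
lemma exists_gap_of_lt_iSup {d : ℕ} {γ : Fin d → Fin d → ℝ} {i : Fin d}
    (h : ∀ v : Fin d → ℝ, (∀ j, 0 ≤ v j) → v ≠ 0 → v i = 0 →
      ∑ j, γ i j * v j < ⨆ l : Fin d, ∑ j, γ l j * v j) :
    ∃ δ > 0, ∀ v : Fin d → ℝ, (∀ j, 0 ≤ v j) → v i = 0 →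
      ∃ l, ∑ j, γ i j * v j + δ * ∑ j, v j ≤ ∑ j, γ l j * v j := by
  have hne : (Finset.univ : Finset (Fin d)).Nonempty := ⟨i, Finset.mem_univ i⟩
  have : Nonempty (Fin d) := ⟨i⟩
  have hcompact : IsCompact (stdSimplex ℝ (Fin d) ∩ {v | v i = 0}) :=
    (isCompact_stdSimplex ℝ (Fin d)).inter_right
      (isClosed_eq (continuous_apply i) continuous_const)
  have hcont : Continuous fun v : Fin d → ℝ =>
      Finset.univ.sup' hne fun l => ∑ j, (γ l j - γ i j) * v j :=
    Continuous.finset_sup'_apply hne fun l _ => by fun_prop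
  obtain ⟨δ, hδ, hmin⟩ := hcompact.exists_forall_le' hcont.continuousOn (a := 0) (by
    rintro v ⟨⟨hv, hv1⟩, hvi⟩
    have hv0 : v ≠ 0 := by
      rintro rfl
      simp at hv1
    obtain ⟨l, hl⟩ := exists_lt_of_lt_ciSup (h v hv hv0 hvi)
    refine (Finset.lt_sup'_iff _).2 ⟨l, Finset.mem_univ l, ?_⟩
    simp only [sub_mul, Finset.sum_sub_distrib]
    linarith)
  refine ⟨δ, hδ, fun v hv hvi => ?_⟩
  rcases (Finset.sum_nonneg fun j _ => hv j : 0 ≤ ∑ j, v j).eq_or_lt with hs | hs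
  · exact ⟨i, by simp [← hs]⟩
  have hle := hmin (fun j => v j / ∑ k, v k)
    ⟨⟨fun j => div_nonneg (hv j) hs.le, by rw [← Finset.sum_div, div_self hs.ne']⟩,
      by simp [hvi]⟩
  obtain ⟨l, -, hl⟩ := (Finset.le_sup'_iff _).1 hle
  refine ⟨l, ?_⟩
  simp only [← mul_div_assoc, ← Finset.sum_div, sub_mul, Finset.sum_sub_distrib] at hl
  rw [le_div_iff₀ hs] at hl
  linarith

lemma tendsto_sum_nat_cofinite (d : ℕ) :
    Tendsto (fun x : Fin d → ℕ => ((∑ j, x j : ℕ) : ℝ)) cofinite atTop := by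
  refine tendsto_natCast_atTop_atTop.comp ?_
  rw [← Nat.cofinite_eq_atTop]
  refine Tendsto.cofinite_of_finite_preimage_singleton fun n => ?_
  refine (Set.finite_Iic (fun _ : Fin d => n)).subset fun x hx j => ?_
  rw [← (hx : ∑ j, x j = n)]
  exact Finset.single_le_sum (fun _ _ => Nat.zero_le _) (Finset.mem_univ j)

lemma prod_pow_eq_exp {d : ℕ} {a : Fin d → ℝ} (ha : ∀ j, 0 < a j) (x : Fin d → ℕ) :
    ∏ j, a j ^ x j = Real.exp (∑ j, Real.log (a j) * (x j : ℝ)) := by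
  rw [Real.exp_sum]
  refine Finset.prod_congr rfl fun j _ => ?_
  rw [mul_comm, Real.exp_nat_mul, Real.exp_log (ha j)]

/-- The `i`-th product form term is negligible on the face `x_i = 0`. -/
lemma tendsto_weight_face {d : ℕ} {a : Fin d → Fin d → ℝ} (ha : ∀ l j, 0 < a l j) {i : Fin d}
    (h : ∀ v : Fin d → ℝ, (∀ j, 0 ≤ v j) → v ≠ 0 → v i = 0 →
      ∑ j, Real.log (a i j) * v j < ⨆ l : Fin d, ∑ j, Real.log (a l j) * v j) :
    Tendsto (fun x : Fin d → ℕ =>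
      if x i = 0 then (∏ j, a i j ^ x j) / ∑ l, ∏ j, a l j ^ x j else 0) cofinite (nhds 0) := by
  obtain ⟨δ, hδ, hgap⟩ := exists_gap_of_lt_iSup (γ := fun l j => Real.log (a l j)) h
  have hpos : ∀ l (x : Fin d → ℕ), 0 < ∏ j, a l j ^ x j := fun l x =>
    Finset.prod_pos fun j _ => pow_pos (ha l j) _
  refine squeeze_zero (g := fun x : Fin d → ℕ => Real.exp (-(δ * ((∑ j, x j : ℕ) : ℝ))))
    (fun x => ?_) (fun x => ?_) ?_
  · split_ifs
    · exact div_nonneg (hpos i x).le (Finset.sum_nonneg fun l _ => (hpos l x).le)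
    · rfl
  · split_ifs with hx
    · obtain ⟨l, hl⟩ := hgap (fun j => x j) (fun j => Nat.cast_nonneg _) (by simp [hx])
      calc (∏ j, a i j ^ x j) / ∑ l, ∏ j, a l j ^ x j
          ≤ (∏ j, a i j ^ x j) / ∏ j, a l j ^ x j :=
            div_le_div_of_nonneg_left (hpos i x).le (hpos l x)
              (Finset.single_le_sum (f := fun l => ∏ j, a l j ^ x j)
                (fun l _ => (hpos l x).le) (Finset.mem_univ l))
        _ ≤ _ := by
            rw [prod_pow_eq_exp (ha i), prod_pow_eq_exp (ha l), ← Real.exp_sub, Real.exp_le_exp]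
            push_cast
            linarith
    · positivity
  · exact Real.tendsto_exp_neg_atTop_nhds_zero.comp
      ((tendsto_sum_nat_cofinite d).const_mul_atTop hδ)

/-- A convex combination of drifts whose weights vanish asymptotically on the faces `x_i = 0` has
the largest interior drift as its upper limit. -/
lemma limsup_weighted_drift {d : ℕ} [Nonempty (Fin d)] {w : Fin d → (Fin d → ℕ) → ℝ}
    (hw0 : ∀ i x, 0 ≤ w i x) (hw1 : ∀ x, ∑ i, w i x = 1)
    (hw : ∀ i, Tendsto (fun x : Fin d → ℕ => if x i = 0 then w i x else 0) cofinite (nhds 0))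
    (p : Fin d → ℝ) {b : Fin d → ℝ} (hb : ∀ i, 0 ≤ b i) :
    Filter.limsup (fun x : Fin d → ℕ => ∑ i, w i x * (p i - if 0 < x i then b i else 0)) cofinite
      = -(⨅ i, (b i - p i)) := by
  set m := ⨅ i, (b i - p i) with hm
  have hmle : ∀ i, m ≤ b i - p i := fun i =>
    ciInf_le (f := fun i => b i - p i) (Finite.bddBelow_range _) i
  set r : Fin d → (Fin d → ℕ) → ℝ := fun i x => if x i = 0 then w i x else 0 with hr
  have hr0 : ∀ i x, 0 ≤ r i x := fun i x => by
    simp only [hr]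
    split_ifs
    exacts [hw0 i x, le_rfl]
  have hsum : ∀ c : Fin d → ℝ, Tendsto (fun x => ∑ i, c i * r i x) cofinite (nhds 0) := fun c => by
    simpa only [mul_zero, Finset.sum_const_zero] using
      tendsto_finsetSum Finset.univ fun i _ => (hw i).const_mul (c i)
  have key : ∀ x : Fin d → ℕ, ∑ i, w i x * (p i - if 0 < x i then b i else 0)
      = -m - ∑ i, (b i - p i - m) * w i x + ∑ i, b i * r i x := by
    intro x
    have : -m = ∑ i, -m * w i x := by rw [← Finset.mul_sum, hw1, mul_one]
    rw [this, ← Finset.sum_sub_distrib, ← Finset.sum_add_distrib]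
    refine Finset.sum_congr rfl fun i _ => ?_
    rcases Nat.eq_zero_or_pos (x i) with hx | hx
    · simp only [hr, hx, lt_irrefl, if_false, if_true]
      ring
    · simp only [hr, hx, hx.ne', if_false, if_true]
      ring
  refine limsup_eq_of_forall_eventually_of_forall_frequently (fun δ hδ => ?_) fun δ hδ => ?_
  · filter_upwards [(hsum b).eventually_lt_const hδ] with x hx
    rw [key]
    have : 0 ≤ ∑ i, (b i - p i - m) * w i x :=
      Finset.sum_nonneg fun i _ => mul_nonneg (sub_nonneg.2 (hmle i)) (hw0 i x)
    linarith
  · obtain ⟨k, hk⟩ := exists_eq_ciInf_of_finite (f := fun i => b i - p i)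
    have hray : Tendsto (fun n : ℕ => (Pi.single k n : Fin d → ℕ)) atTop cofinite := by
      rw [← Nat.cofinite_eq_atTop]
      exact (Pi.single_injective k).tendsto_cofinite
    refine hray.frequently (Eventually.frequently ?_)
    filter_upwards [hray.eventually
      ((hsum fun i => b i - p i - m).eventually_lt_const hδ)] with n hn
    rw [key]
    have h1 : ∑ i, (b i - p i - m) * w i (Pi.single k n)
        = ∑ i, (b i - p i - m) * r i (Pi.single k n) := by
      refine Finset.sum_congr rfl fun i _ => ?_
      by_cases hi : i = k
      · subst hi
        have : b i - p i - m = 0 := sub_eq_zero.2 hk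
        simp [this]
      · simp [hr, hi]
    have h2 : 0 ≤ ∑ i, b i * r i (Pi.single k n) :=
      Finset.sum_nonneg fun i _ => mul_nonneg (hb i) (hr0 i _)
    linarith

/-- Corollary 2.1: if ρ satisfies (ρP)_i < ρ_i for all i, ε > 0 is such that the vector
(ε G_ii / ρ_i)_i belongs to Γ and ε < min_i (ρ_i/G_ii)(μ_i/ν_i - 1), then
h_{ε,ρ}(x) = Σ_i Π_j (1 + ε G_ji / ρ_i)^{x_j} satisfies
limsup (ℒ h)(x)/h(x) = -ε min_i (μ_i/(ρ_i + ε G_ii) - ν_i/ρ_i) < 0.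
In particular, the hypotheses hold whenever
0 < ε < min_i min {(ρ_i/G_ii) x_ρ, (ρ_i/G_ii)(μ_i/ν_i - 1)}. -/
theorem stmt4
    (d : ℕ) (hd : 0 < d)
    (lam mu : Fin d → ℝ) (P : Fin d → Fin d → ℝ)
    (hlam : ∀ i, 0 ≤ lam i) (hmu : ∀ i, 0 < mu i)
    (hP : ∀ i j, 0 ≤ P i j) (hPdiag : ∀ i, P i i = 0) (hP0 : ∀ i, ∑ j, P i j ≤ 1)
    (hA : AssumptionA lam mu P)
    (G : Fin d → Fin d → ℝ)
    (hG1 : ∀ i k, ∑ j, G i j * ((if j = k then (1 : ℝ) else 0) - P j k)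
      = if i = k then 1 else 0)
    (hG2 : ∀ i k, ∑ j, ((if i = j then (1 : ℝ) else 0) - P i j) * G j k
      = if i = k then 1 else 0)
    (hGnn : ∀ i j, 0 ≤ G i j) (hGdiag : ∀ i, 1 ≤ G i i)
    (ν : Fin d → ℝ) (hν : ∀ j, ν j = lam j + ∑ i, ν i * P i j) (hνpos : ∀ i, 0 < ν i)
    (hB : ∀ i, ν i < mu i)
    (ρ : Fin d → ℝ) (hρ : ∀ i, ∑ j, ρ j * P j i < ρ i)
    (ε : ℝ) (hε : 0 < ε)
    (hγΓ : (fun i => ε * G i i / ρ i) ∈ GammaSet d (hitQ G))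
    (hεlt : ∀ i : Fin d, ε < ρ i / G i i * (mu i / ν i - 1)) :
    (Filter.limsup
        (fun x : Fin d → ℕ =>
          gen lam mu P (fun y => ∑ i, ∏ j, (1 + ε * G j i / ρ i) ^ (y j)) x
            / ∑ i, ∏ j, (1 + ε * G j i / ρ i) ^ (x j))
        Filter.cofinite
      = -(ε * ⨅ i : Fin d, (mu i / (ρ i + ε * G i i) - ν i / ρ i))
      ∧ 0 < ε * ⨅ i : Fin d, (mu i / (ρ i + ε * G i i) - ν i / ρ i))
    ∧ ∀ ε' : ℝ, 0 < ε' →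
        (∀ i : Fin d, (ε' : EReal) <
          min (((ρ i / G i i : ℝ) : EReal) * xrho (Rrho P ρ))
            ((ρ i / G i i * (mu i / ν i - 1) : ℝ) : EReal)) →
        ((fun i => ε' * G i i / ρ i) ∈ GammaSet d (hitQ G)
          ∧ ∀ i : Fin d, ε' < ρ i / G i i * (mu i / ν i - 1)) := by
  have hGP : ∀ i k, ∑ j, G i j * P j k = G i k - if i = k then 1 else 0 := fun i k => by
    rw [← hG1 i k]
    simp [mul_sub]
  have hPG : ∀ i k, ∑ j, P i j * G j k = G i k - if i = k then 1 else 0 := fun i k => by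
    rw [← hG2 i k]
    simp [sub_mul]
  have hGpos : ∀ i, 0 < G i i := fun i => one_pos.trans_le (hGdiag i)
  have hρpos : ∀ i, 0 < ρ i := fun i => by
    rw [← apply_green_eq_sum hPG ρ i]
    exact Finset.sum_pos' (fun j _ => mul_nonneg (sub_nonneg.2 (hρ j).le) (hGnn j i))
      ⟨i, Finset.mem_univ i, mul_pos (sub_pos.2 (hρ i)) (hGpos i)⟩
  have hνG : ∀ i, ∑ j, lam j * G j i = ν i := fun i => by
    rw [← apply_green_eq_sum hPG ν i]
    exact Finset.sum_congr rfl fun j _ => by rw [hν j]; ring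
  have : Nonempty (Fin d) := ⟨⟨0, hd⟩⟩
  refine ⟨⟨?_, ?_⟩, fun ε' hε' hlt => ⟨?_, fun i => ?_⟩⟩
  · have hapos : ∀ i j, 0 < 1 + ε * G j i / ρ i := fun i j => by
      have := hGnn j i
      have := hρpos i
      positivity
    have hHpos : ∀ i (x : Fin d → ℕ), 0 < ∏ j, (1 + ε * G j i / ρ i) ^ x j := fun i x =>
      Finset.prod_pos fun j _ => pow_pos (hapos i j) _
    have hhpos : ∀ x : Fin d → ℕ, 0 < ∑ i, ∏ j, (1 + ε * G j i / ρ i) ^ x j := fun x =>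
      Finset.sum_pos (fun i _ => hHpos i x) Finset.univ_nonempty
    have hgen : ∀ x : Fin d → ℕ,
        gen lam mu P (fun y => ∑ i, ∏ j, (1 + ε * G j i / ρ i) ^ (y j)) x
          = ∑ i, (∏ j, (1 + ε * G j i / ρ i) ^ x j) *
            (ε * (ν i / ρ i) - if 0 < x i then ε * (mu i / (ρ i + ε * G i i)) else 0) := by
      intro x
      refine HasSum.tsum_eq ?_
      simp only [← Finset.sum_sub_distrib, Finset.mul_sum]
      refine hasSum_sum fun i _ => ?_
      have hi := (hρpos i).ne'
      have hc : ∀ j, 1 + ε * G j i / ρ i = 1 + ε / ρ i * G j i := fun j => by ring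
      simp only [hc]
      convert hasSum_gen_prod hPdiag (fun j => hGnn j i) (hPG · i)
        (div_pos hε (hρpos i)).le x using 3
      · rw [hνG]
        ring
      · congr 1
        have : ρ i + ε * G i i ≠ 0 := by
          have := hGpos i
          have := hρpos i
          positivity
        field_simp
    have hgvec : ∀ l j, gvec (hitQ G) (fun i => ε * G i i / ρ i) l j
        = Real.log (1 + ε * G j l / ρ l) := fun l j => gvec_hitQ (hGpos l).ne' ρ ε j
    have hface : ∀ i, Tendsto (fun x : Fin d → ℕ => if x i = 0 then
        (∏ j, (1 + ε * G j i / ρ i) ^ x j) / ∑ l, ∏ j, (1 + ε * G j l / ρ l) ^ x j else 0)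
        cofinite (nhds 0) := fun i =>
      tendsto_weight_face hapos fun v hv hv0 hvi => by
        simpa only [hgvec] using hγΓ.2 i v hv hv0 hvi
    have hlimsup := limsup_weighted_drift
      (fun i x => (div_pos (hHpos i x) (hhpos x)).le)
      (fun x => by rw [← Finset.sum_div, div_self (hhpos x).ne'])
      hface (fun i => ε * (ν i / ρ i)) (b := fun i => ε * (mu i / (ρ i + ε * G i i)))
      fun i => by
        have := hGpos i
        have := hρpos i
        have := hmu i
        positivity
    simp only [Real.mul_iInf_of_nonneg hε.le, mul_sub]
    rw [← hlimsup]
    congr 1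
    funext x
    rw [hgen, Finset.sum_div]
    exact Finset.sum_congr rfl fun i _ => mul_div_right_comm _ _ _
  · obtain ⟨k, hk⟩ := exists_eq_ciInf_of_finite
      (f := fun i => mu i / (ρ i + ε * G i i) - ν i / ρ i)
    rw [← hk]
    refine mul_pos hε (sub_pos.2 ?_)
    have := hGpos k
    have := hρpos k
    have := hνpos k
    have h := hεlt k
    rw [div_lt_div_iff₀ (by positivity) (by positivity)]
    have : ρ k / G k k * (mu k / ν k - 1) = (ρ k * mu k - ρ k * ν k) / (G k k * ν k) := by
      field_simp
    rw [this, lt_div_iff₀ (by positivity)] at h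
    linarith
  · refine mem_GammaSet_of_lt_xrho hP hP0 hGnn hGpos hGP hPG hρpos hε' fun i => ?_
    have hi := (hlt i).trans_le (min_le_left _ _)
    by_contra! hcon
    refine hi.not_ge ?_
    have hpos := div_pos (hρpos i) (hGpos i)
    calc ((ρ i / G i i : ℝ) : EReal) * xrho (Rrho P ρ)
        ≤ ((ρ i / G i i : ℝ) : EReal) * ((ε' * G i i / ρ i : ℝ) : EReal) :=
          mul_le_mul_of_nonneg_left hcon (EReal.coe_nonneg.2 hpos.le)
      _ = ε' := by
          rw [← EReal.coe_mul, EReal.coe_eq_coe_iff]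
          have := (hρpos i).ne'
          have := (hGpos i).ne'
          field_simp
  · exact EReal.coe_lt_coe_iff.1 ((hlt i).trans_le (min_le_right _ _))
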